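/- Assume N ≥ 3 and p > 1 + 4/(N−2). Let Θ : [0,1) × [0,∞) → ℝ be any continuous function such that tan Θ(ρ,c) = ρ ∂_ρ w(ρ,c) / w(ρ,c) whenever w(ρ,c) ≠ 0, Θ(ρ,c) ∈ π/2 + πℤ exactly when w(ρ,c) = 0, and Θ(0,c) = π for all c ≥ 0. Then for all 0 ≤ ρ₁ < ρ₂ < 1 and all c ≥ 0, the number of zeros of the function ρ ↦ w(ρ,c) on the half-open interval [ρ₁, ρ₂) equals ⌊Θ(ρ₁,c)/π − 1/2⌋ − ⌊Θ(ρ₂,c)/π − 1/2⌋, where ⌊x⌋ denotes the integer part of x. -/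

import Mathlib

open Set Filter

noncomputable def alphaP (p : ℝ) : ℝ := 2 / (p - 1)

noncomputable def b0 (p : ℝ) : ℝ := (2 * (p + 1) / (p - 1) ^ 2) ^ ((1 : ℝ) / (p - 1))

noncomputable def bInf (N : ℕ) (p : ℝ) : ℝ :=
  (alphaP p * ((N : ℝ) - 2 - alphaP p)) ^ (alphaP p / 2)

noncomputable def uInf (N : ℕ) (p : ℝ) (ρ : ℝ) : ℝ := bInf N p * ρ ^ (-(alphaP p))

/-- `u` solves `(1-ρ²)u'' + ((N-1)/ρ - 2(α+1)ρ)u' - α(α+1)u + |u|^{p-1}u = 0` on `s`. -/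
def IsSolOn (N : ℕ) (p : ℝ) (u : ℝ → ℝ) (s : Set ℝ) : Prop :=
  ∀ ρ ∈ s,
    (1 - ρ ^ 2) * deriv (deriv u) ρ
      + (((N : ℝ) - 1) / ρ - 2 * (alphaP p + 1) * ρ) * deriv u ρ
      - alphaP p * (alphaP p + 1) * u ρ + |u ρ| ^ (p - 1) * u ρ = 0

/-- `w(ρ,c) = u(ρ,c)/u_∞(ρ) - 1`; by Lean's division-by-zero convention this
equals `-1` at `ρ = 0`, matching the convention `w(0,c) = -1`. -/
noncomputable def wFun (N : ℕ) (p : ℝ) (u : ℝ → ℝ → ℝ) (c ρ : ℝ) : ℝ :=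
  u c ρ / uInf N p ρ - 1

open scoped Topology

/-- `φ` has finitely many integer points in `[x, y)`, and their number is the drop of `⌊φ⌋`. -/
def FloorDropCounts (φ : ℝ → ℝ) (x y : ℝ) : Prop :=
  {t ∈ Ico x y | ∃ k : ℤ, φ t = k}.Finite ∧
    ({t ∈ Ico x y | ∃ k : ℤ, φ t = k}.ncard : ℤ) = ⌊φ x⌋ - ⌊φ y⌋

lemma FloorDropCounts.trans_iff {φ : ℝ → ℝ} {a x y : ℝ} (hax : a ≤ x) (hxy : x ≤ y)
    (h : FloorDropCounts φ x y) : FloorDropCounts φ a x ↔ FloorDropCounts φ a y := by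
  have hun : {t ∈ Ico a y | ∃ k : ℤ, φ t = k} =
      {t ∈ Ico a x | ∃ k : ℤ, φ t = k} ∪ {t ∈ Ico x y | ∃ k : ℤ, φ t = k} := by
    rw [← Ico_union_Ico_eq_Ico hax hxy]
    ext t
    simp only [mem_ofPred_eq, mem_union]
    tauto
  have hdis : Disjoint {t ∈ Ico a x | ∃ k : ℤ, φ t = k} {t ∈ Ico x y | ∃ k : ℤ, φ t = k} :=
    Set.disjoint_left.2 fun t ht ht' => ht.1.2.not_ge ht'.1.1
  obtain ⟨hfin, hcard⟩ := h
  unfold FloorDropCounts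
  rw [hun, finite_union, and_iff_left hfin]
  refine and_congr_right fun hf => ?_
  rw [ncard_union_eq hdis hf hfin]
  push_cast
  constructor <;> intro h <;> linarith

lemma floorDropCounts_of_forall_mem_Ioo {φ : ℝ → ℝ} {x y : ℝ} {n : ℤ}
    (h : ∀ t ∈ Ico x y, (n : ℝ) < φ t ∧ φ t < n + 1) (hx : ⌊φ x⌋ = n) (hy : ⌊φ y⌋ = n) :
    FloorDropCounts φ x y := by
  have : {t ∈ Ico x y | ∃ k : ℤ, φ t = k} = ∅ := by
    refine eq_empty_of_forall_notMem ?_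
    rintro t ⟨ht, k, hk⟩
    obtain ⟨h1, h2⟩ := h t ht
    rw [hk] at h1 h2
    norm_cast at h1 h2
    omega
  rw [FloorDropCounts, this]
  simp [hx, hy]

lemma floorDropCounts_of_eq_of_forall_mem_Ioo {φ : ℝ → ℝ} {x y : ℝ} {n : ℤ} (hxy : x < y)
    (hx : φ x = n) (h : ∀ t ∈ Ioc x y, (n : ℝ) - 1 < φ t ∧ φ t < n) :
    FloorDropCounts φ x y := by
  have hs : {t ∈ Ico x y | ∃ k : ℤ, φ t = k} = {x} := by
    ext t
    simp only [mem_ofPred_eq, mem_singleton_iff]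
    constructor
    · rintro ⟨ht, k, hk⟩
      by_contra hne
      obtain ⟨h1, h2⟩ := h t ⟨lt_of_le_of_ne ht.1 (Ne.symm hne), ht.2.le⟩
      rw [hk] at h1 h2
      norm_cast at h1 h2
      omega
    · rintro rfl
      exact ⟨⟨le_rfl, hxy⟩, n, hx⟩
  have hy : ⌊φ y⌋ = n - 1 := by
    obtain ⟨h1, h2⟩ := h y ⟨hxy, le_rfl⟩
    rw [Int.floor_eq_iff]
    push_cast
    exact ⟨h1.le, by linarith⟩
  rw [FloorDropCounts, hs]
  simp [hx, hy]

/-- A continuous function that crosses every integer strictly downwards takes integer values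
on `[a, b)` exactly as often as its integer part drops. -/
theorem floorDropCounts_of_strict_crossing {φ : ℝ → ℝ} {a b : ℝ} (hab : a ≤ b)
    (hφ : ContinuousOn φ (Icc a b))
    (hcross : ∀ x ∈ Icc a b, ∀ k : ℤ, φ x = k →
      (∀ᶠ y in 𝓝[>] x, φ y < k) ∧ (∀ᶠ y in 𝓝[<] x, k < φ y)) :
    FloorDropCounts φ a b := by
  have hloc : ∀ x ∈ Icc a b, ∀ᶠ y in 𝓝[Icc a b] x,
      (FloorDropCounts φ a x ↔ FloorDropCounts φ a y) := by
    intro x hx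
    set n := ⌊φ x⌋ with hn
    have hlt : φ x < n + 1 := Int.lt_floor_add_one _
    have hle : (n : ℝ) ≤ φ x := Int.floor_le _
    have hev : ∀ᶠ y in 𝓝[Icc a b] x, (n - 1 < φ y ∧ φ y < n + 1) ∧ (φ x ≠ n → n < φ y) ∧
        (φ x = n → (x < y → φ y < n) ∧ (y < x → n < φ y)) := by
      have h1 := (hφ x hx).eventually_lt_const hlt
      have h2 := (hφ x hx).eventually_const_lt (show (n : ℝ) - 1 < φ x by linarith)
      have h3 : ∀ᶠ y in 𝓝[Icc a b] x, φ x ≠ n → n < φ y := by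
        by_cases h : φ x = n
        · simp [h]
        · filter_upwards [(hφ x hx).eventually_const_lt (lt_of_le_of_ne hle (Ne.symm h))]
            with y hy _ using hy
      have h4 : ∀ᶠ y in 𝓝[Icc a b] x, φ x = n → (x < y → φ y < n) ∧ (y < x → n < φ y) := by
        by_cases h : φ x = n
        · obtain ⟨hr, hl⟩ := hcross x hx n h
          rw [eventually_nhdsWithin_iff] at hr hl
          filter_upwards [hr.filter_mono nhdsWithin_le_nhds, hl.filter_mono nhdsWithin_le_nhds]
            with y hy1 hy2 _ using ⟨hy1, hy2⟩
        · simp [h]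
      filter_upwards [h1, h2, h3, h4] with y h1 h2 h3 h4 using ⟨⟨h2, h1⟩, h3, h4⟩
    rw [eventually_nhdsWithin_iff, Metric.eventually_nhds_iff] at hev ⊢
    obtain ⟨ε, hε, hball⟩ := hev
    refine ⟨ε, hε, fun y hy hys => ?_⟩
    rw [Real.dist_eq, abs_lt] at hy
    have key : ∀ t, min x y ≤ t → t ≤ max x y → (n - 1 < φ t ∧ φ t < n + 1) ∧
        (φ x ≠ n → n < φ t) ∧ (φ x = n → (x < t → φ t < n) ∧ (t < x → n < φ t)) := by
      intro t ht1 ht2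
      refine hball ?_ ⟨(le_min hx.1 hys.1).trans ht1, ht2.trans (max_le hx.2 hys.2)⟩
      rw [Real.dist_eq, abs_lt]
      rcases le_total x y with h | h <;> simp only [h, min_eq_left, min_eq_right, max_eq_left,
        max_eq_right] at ht1 ht2 <;> constructor <;> linarith
    rcases lt_trichotomy x y with hxy | rfl | hxy
    · rw [min_eq_left hxy.le, max_eq_right hxy.le] at key
      refine FloorDropCounts.trans_iff hx.1 hxy.le ?_
      by_cases h : φ x = n
      · exact floorDropCounts_of_eq_of_forall_mem_Ioo hxy h fun t ht =>
          have ht' := key t ht.1.le ht.2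
          ⟨ht'.1.1, (ht'.2.2 h).1 ht.1⟩
      · have hin : ∀ t ∈ Icc x y, (n : ℝ) < φ t ∧ φ t < n + 1 := fun t ht =>
          ⟨(key t ht.1 ht.2).2.1 h, (key t ht.1 ht.2).1.2⟩
        have hyI := hin y ⟨hxy.le, le_rfl⟩
        exact floorDropCounts_of_forall_mem_Ioo (fun t ht => hin t ⟨ht.1, ht.2.le⟩) rfl
          (Int.floor_eq_iff.2 ⟨hyI.1.le, hyI.2⟩)
    · rfl
    · rw [min_eq_right hxy.le, max_eq_left hxy.le] at key
      refine (FloorDropCounts.trans_iff hys.1 hxy.le ?_).symm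
      have hin : ∀ t ∈ Ico y x, (n : ℝ) < φ t ∧ φ t < n + 1 := fun t ht => by
        have ht' := key t ht.1 ht.2.le
        by_cases h : φ x = n
        · exact ⟨(ht'.2.2 h).2 ht.2, ht'.1.2⟩
        · exact ⟨ht'.2.1 h, ht'.1.2⟩
      have hyI := hin y ⟨le_rfl, hxy⟩
      exact floorDropCounts_of_forall_mem_Ioo hin (Int.floor_eq_iff.2 ⟨hyI.1.le, hyI.2⟩) rfl
  have hiff := isPreconnected_Icc.induction₂
    (fun x y => FloorDropCounts φ a x ↔ FloorDropCounts φ a y) hloc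
    (fun _ _ _ _ _ _ h h' => h.trans h') (fun _ _ _ _ h => h.symm)
    (left_mem_Icc.2 hab) (right_mem_Icc.2 hab)
  exact hiff.1 (by simp [FloorDropCounts])

lemma exists_lipschitzOnWith_abs_rpow_mul {p : ℝ} (hp : 1 < p) (R : ℝ) :
    ∃ K, LipschitzOnWith K (fun x : ℝ => |x| ^ (p - 1) * x) (Icc (-R) R) := by
  have hcd : ContDiff ℝ 1 fun x : ℝ => x ^ p := by
    exact_mod_cast Real.contDiff_rpow_const_of_le (n := 1) (by exact_mod_cast hp.le)
  obtain ⟨K, hK⟩ := hcd.contDiffOn.exists_lipschitzOnWith one_ne_zero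
    (convex_Icc (-|R|) |R|) isCompact_Icc
  have hm : LipschitzOnWith K (fun x : ℝ => (max x 0) ^ p) (Icc (-R) R) := by
    have := hK.comp ((LipschitzWith.id.max_const 0).lipschitzOnWith (s := Icc (-R) R)) (fun x hx => ?_)
    · simpa [Function.comp_def] using this
    · exact ⟨(neg_nonpos.2 (abs_nonneg R)).trans (le_max_right _ _),
        max_le (hx.2.trans (le_abs_self R)) (abs_nonneg R)⟩
  have hm' : LipschitzOnWith K (fun x : ℝ => (max (-x) 0) ^ p) (Icc (-R) R) := by
    have := hm.comp (LipschitzWith.id.neg.lipschitzOnWith (s := Icc (-R) R))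
      (fun x hx => ⟨neg_le_neg hx.2, neg_le.1 hx.1⟩)
    simpa [Function.comp_def] using this
  have hp0 : (0 : ℝ) ^ p = 0 := Real.zero_rpow (by linarith)
  have hpow : ∀ y : ℝ, 0 ≤ y → y ^ p = y ^ (p - 1) * y := fun y hy => by
    rcases hy.eq_or_lt with rfl | hy
    · simp [hp0]
    · rw [← Real.rpow_add_one hy.ne', sub_add_cancel]
  suffices heq : (fun x : ℝ => |x| ^ (p - 1) * x) =
      fun x => max x 0 ^ p - max (-x) 0 ^ p from
    ⟨K + K, heq ▸ hm.sub hm'⟩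
  ext x
  rcases le_total 0 x with h | h
  · simp [abs_of_nonneg h, h, hp0, hpow x h]
  · simp [abs_of_nonpos h, h, hp0, hpow (-x) (by linarith)]

/-- Uniqueness, backwards in time, for `x'' = A x' + B x + C f(x)` with `f` Lipschitz on
bounded sets. -/
theorem eqOn_of_second_order_ode {a b : ℝ} {A B C f : ℝ → ℝ}
    (hA : ContinuousOn A (Icc a b)) (hB : ContinuousOn B (Icc a b))
    (hC : ContinuousOn C (Icc a b))
    (hf : ∀ R : ℝ, ∃ K, LipschitzOnWith K f (Icc (-R) R)) {x x' y y' : ℝ → ℝ}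
    (hx : ∀ t ∈ Icc a b, HasDerivAt x (x' t) t)
    (hx' : ∀ t ∈ Icc a b, HasDerivAt x' (A t * x' t + B t * x t + C t * f (x t)) t)
    (hy : ∀ t ∈ Icc a b, HasDerivAt y (y' t) t)
    (hy' : ∀ t ∈ Icc a b, HasDerivAt y' (A t * y' t + B t * y t + C t * f (y t)) t)
    (hb : x b = y b) (hb' : x' b = y' b) : EqOn x y (Icc a b) := by
  obtain ⟨MA, hMA⟩ := isCompact_Icc.exists_bound_of_continuousOn hA
  obtain ⟨MB, hMB⟩ := isCompact_Icc.exists_bound_of_continuousOn hB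
  obtain ⟨MC, hMC⟩ := isCompact_Icc.exists_bound_of_continuousOn hC
  obtain ⟨Rx, hRx⟩ := isCompact_Icc.exists_bound_of_continuousOn
    (fun t ht => (hx t ht).continuousAt.continuousWithinAt)
  obtain ⟨Ry, hRy⟩ := isCompact_Icc.exists_bound_of_continuousOn
    (fun t ht => (hy t ht).continuousAt.continuousWithinAt)
  obtain ⟨K, hK⟩ := hf (max Rx Ry)
  let v : ℝ → ℝ × ℝ → ℝ × ℝ := fun t q => (q.2, A t * q.2 + B t * q.1 + C t * f q.1)
  let s : ℝ → Set (ℝ × ℝ) := fun _ => {q | q.1 ∈ Icc (-max Rx Ry) (max Rx Ry)}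
  let L : ℝ := 1 + |MA| + |MB| + |MC| * K
  have hL : 0 ≤ L := by positivity
  have hlip : ∀ t ∈ Ioc a b, LipschitzOnWith L.toNNReal (v t) (s t) := by
    intro t ht
    have ht' : t ∈ Icc a b := ⟨ht.1.le, ht.2⟩
    refine LipschitzOnWith.of_dist_le_mul fun q hq r hr => ?_
    rw [Real.coe_toNNReal _ hL]
    set d := dist q r
    have hd : 0 ≤ d := dist_nonneg
    have h1 : |q.1 - r.1| ≤ d := by rw [← Real.dist_eq]; exact le_max_left _ _
    have h2 : |q.2 - r.2| ≤ d := by rw [← Real.dist_eq]; exact le_max_right _ _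
    have h3 : |f q.1 - f r.1| ≤ K * d := by
      have := hK.dist_le_mul _ hq _ hr
      rw [Real.dist_eq, Real.dist_eq] at this
      exact this.trans (by gcongr)
    have hA' : |A t| ≤ |MA| := (hMA t ht').trans (le_abs_self _)
    have hB' : |B t| ≤ |MB| := (hMB t ht').trans (le_abs_self _)
    have hC' : |C t| ≤ |MC| := (hMC t ht').trans (le_abs_self _)
    have hsum : |A t * (q.2 - r.2) + B t * (q.1 - r.1) + C t * (f q.1 - f r.1)|
        ≤ |MA| * d + |MB| * d + |MC| * (K * d) := by
      refine (abs_add_three _ _ _).trans ?_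
      rw [abs_mul, abs_mul, abs_mul]
      gcongr
    refine max_le ?_ ?_
    · rw [Real.dist_eq]
      have : 0 ≤ (|MA| + |MB| + |MC| * K) * d := by positivity
      simp only [v, L]
      linarith
    · rw [Real.dist_eq]
      simp only [v, L]
      convert hsum.trans (?_ : _ ≤ (1 + |MA| + |MB| + |MC| * K) * d) using 2
      · ring
      · linarith
  have hbd : ∀ {z : ℝ → ℝ} {z' : ℝ → ℝ} {R : ℝ}, R ≤ max Rx Ry → (∀ t ∈ Icc a b, ‖z t‖ ≤ R) →
      ∀ t ∈ Ioc a b, (z t, z' t) ∈ s t := fun hR hz t ht =>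
    abs_le.1 ((hz t ⟨ht.1.le, ht.2⟩).trans hR)
  have hcont : ∀ {z z' g : ℝ → ℝ}, (∀ t ∈ Icc a b, HasDerivAt z (z' t) t) →
      (∀ t ∈ Icc a b, HasDerivAt z' (g t) t) →
      ContinuousOn (fun t => (z t, z' t)) (Icc a b) := fun hz hz' t ht =>
    ((hz t ht).continuousAt.prodMk (hz' t ht).continuousAt).continuousWithinAt
  have huniq := ODE_solution_unique_of_mem_Icc_left (v := v) (s := s) (a := a) (b := b)
    (f := fun t => (x t, x' t)) (g := fun t => (y t, y' t)) hlip (hcont hx hx')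
    (fun t ht => ((hx t ⟨ht.1.le, ht.2⟩).prodMk (hx' t ⟨ht.1.le, ht.2⟩)).hasDerivWithinAt)
    (hbd (le_max_left _ _) hRx) (hcont hy hy')
    (fun t ht => ((hy t ⟨ht.1.le, ht.2⟩).prodMk (hy' t ⟨ht.1.le, ht.2⟩)).hasDerivWithinAt)
    (hbd (le_max_right _ _) hRy) (by simp [hb, hb'])
  exact fun t ht => congrArg Prod.fst (huniq ht)

lemma div_pi_lt_of_tan_pos {θ : ℝ} {k : ℤ}
    (h2 : θ / Real.pi - 1 / 2 < k + 1 / 2) (ht : 0 < Real.tan θ) : θ / Real.pi - 1 / 2 < k := by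
  have hpi := Real.pi_pos
  by_contra! h
  have hθ : θ = (θ / Real.pi) * Real.pi := by field_simp
  set q := θ / Real.pi
  have := Real.tan_nonpos_of_nonpos_of_neg_pi_div_two_le
    (x := θ - ((k + 1 : ℤ) : ℝ) * Real.pi) (by push_cast; rw [hθ]; nlinarith)
    (by push_cast; rw [hθ]; nlinarith)
  rw [Real.tan_sub_int_mul_pi] at this
  linarith

lemma lt_div_pi_of_tan_neg {θ : ℝ} {k : ℤ} (h1 : (k : ℝ) - 1 / 2 < θ / Real.pi - 1 / 2)
    (ht : Real.tan θ < 0) : k < θ / Real.pi - 1 / 2 := by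
  have hpi := Real.pi_pos
  by_contra! h
  have hθ : θ = (θ / Real.pi) * Real.pi := by field_simp
  set q := θ / Real.pi
  have := Real.tan_nonneg_of_nonneg_of_le_pi_div_two
    (x := θ - (k : ℝ) * Real.pi) (by rw [hθ]; nlinarith)
    (by rw [hθ]; nlinarith)
  rw [Real.tan_sub_int_mul_pi] at this
  linarith

/-- Near a transversal zero the logarithmic derivative has the sign of `y - x`. -/
lemma eventually_deriv_div_sign {w : ℝ → ℝ} {x : ℝ} (hx : w x = 0) (hd : deriv w x ≠ 0)
    (hc : ContinuousAt (deriv w) x) :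
    ∀ᶠ y in 𝓝 x, (x < y → 0 < deriv w y / w y) ∧ (y < x → deriv w y / w y < 0) := by
  rcases hd.lt_or_gt with h | h
  · filter_upwards [eventually_nhdsWithin_sign_eq_of_deriv_neg h hx, hc.eventually_lt_const h]
      with y hy hy'
    constructor <;> intro hxy
    · rw [sign_neg (sub_neg.2 hxy), sign_eq_neg_one_iff] at hy
      exact div_pos_of_neg_of_neg hy' hy
    · rw [sign_pos (sub_pos.2 hxy), sign_eq_one_iff] at hy
      exact div_neg_of_neg_of_pos hy' hy
  · filter_upwards [eventually_nhdsWithin_sign_eq_of_deriv_pos h hx, hc.eventually_const_lt h]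
      with y hy hy'
    constructor <;> intro hxy
    · rw [sign_pos (sub_pos.2 hxy), sign_eq_one_iff] at hy
      exact div_pos hy' hy
    · rw [sign_neg (sub_neg.2 hxy), sign_eq_neg_one_iff] at hy
      exact div_neg_of_pos_of_neg hy' hy

lemma alphaP_pos {p : ℝ} (hp : 1 < p) : 0 < alphaP p := div_pos two_pos (sub_pos.2 hp)

lemma alphaP_mul_sub_pos {N : ℕ} {p : ℝ} (hN : 3 ≤ N) (hp : 1 + 4 / ((N : ℝ) - 2) < p) :
    0 < alphaP p * ((N : ℝ) - 2 - alphaP p) := by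
  have hN' : (3 : ℝ) ≤ N := by exact_mod_cast hN
  have h2 : 0 < (N : ℝ) - 2 := by linarith
  have h4 : 0 < 4 / ((N : ℝ) - 2) := by positivity
  have hp1 : 0 < p - 1 := by linarith
  refine mul_pos (alphaP_pos (by linarith)) (sub_pos.2 ?_)
  have h5 : 4 / ((N : ℝ) - 2) < p - 1 := by linarith
  rw [div_lt_iff₀ h2] at h5
  rw [alphaP, div_lt_iff₀ hp1]
  linarith

lemma hasDerivAt_const_mul_rpow {ρ : ℝ} (hρ : 0 < ρ) (b r : ℝ) :
    HasDerivAt (fun t => b * t ^ r) (b * r * ρ ^ (r - 1)) ρ := by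
  simpa [mul_assoc] using (Real.hasDerivAt_rpow_const (Or.inl hρ.ne')).const_mul b

lemma bInf_pos {N : ℕ} {p : ℝ} (hN : 3 ≤ N) (hp : 1 + 4 / ((N : ℝ) - 2) < p) :
    0 < bInf N p := Real.rpow_pos_of_pos (alphaP_mul_sub_pos hN hp) _

lemma uInf_pos {N : ℕ} {p : ℝ} (hN : 3 ≤ N) (hp : 1 + 4 / ((N : ℝ) - 2) < p) {ρ : ℝ}
    (hρ : 0 < ρ) : 0 < uInf N p ρ := mul_pos (bInf_pos hN hp) (Real.rpow_pos_of_pos hρ _)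

lemma abs_uInf_rpow {N : ℕ} {p : ℝ} (hN : 3 ≤ N) (hp : 1 + 4 / ((N : ℝ) - 2) < p)
    (hp1 : 1 < p) {ρ : ℝ} (hρ : 0 < ρ) :
    |uInf N p ρ| ^ (p - 1) = alphaP p * ((N : ℝ) - 2 - alphaP p) * ρ ^ (-2 : ℝ) := by
  have hα : alphaP p * (p - 1) = 2 := by
    rw [alphaP, div_mul_cancel₀ _ (sub_pos.2 hp1).ne']
  have hpos := alphaP_mul_sub_pos hN hp
  rw [abs_of_pos (uInf_pos hN hp hρ), uInf, Real.mul_rpow (bInf_pos hN hp).le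
    (Real.rpow_nonneg hρ.le _), bInf, ← Real.rpow_mul hpos.le, ← Real.rpow_mul hρ.le,
    show alphaP p / 2 * (p - 1) = 1 by linarith, Real.rpow_one,
    show -alphaP p * (p - 1) = -2 by linarith]

/-- The profile equation solved for the second derivative. -/
lemma profile_second_deriv_iff {ρ : ℝ} (hρ : 0 < ρ) (hρ' : ρ < 1) (N : ℕ) (p d2 d1 d0 g : ℝ) :
    (1 - ρ ^ 2) * d2 + (((N : ℝ) - 1) / ρ - 2 * (alphaP p + 1) * ρ) * d1
        - alphaP p * (alphaP p + 1) * d0 + g = 0 ↔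
      d2 = -(((N : ℝ) - 1) / ρ - 2 * (alphaP p + 1) * ρ) / (1 - ρ ^ 2) * d1
        + alphaP p * (alphaP p + 1) / (1 - ρ ^ 2) * d0 + -1 / (1 - ρ ^ 2) * g := by
  have h : 1 - ρ ^ 2 ≠ 0 := by nlinarith
  rw [div_mul_eq_mul_div, div_mul_eq_mul_div, div_mul_eq_mul_div, ← add_div, ← add_div,
    eq_div_iff h]
  constructor <;> intro h <;> linarith

/-- A bounded profile never touches the singular profile `uInf` tangentially. -/
theorem profile_ne_of_tangent {N : ℕ} {p : ℝ} (hN : 3 ≤ N) (hp : 1 + 4 / ((N : ℝ) - 2) < p)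
    {u : ℝ → ℝ} (hu : ContDiffOn ℝ 2 u (Ico 0 1)) (hsol : IsSolOn N p u (Ioo 0 1))
    {ρ : ℝ} (hρ : ρ ∈ Ioo (0 : ℝ) 1) (h0 : u ρ = uInf N p ρ) :
    deriv u ρ ≠ deriv (uInf N p) ρ := by
  intro h1
  have hN' : (3 : ℝ) ≤ N := by exact_mod_cast hN
  have hp1 : 1 < p := by
    have : 0 < 4 / ((N : ℝ) - 2) := div_pos (by norm_num) (by linarith)
    linarith
  set α := alphaP p with hαdef
  have hα : 0 < α := alphaP_pos hp1
  have hb := bInf_pos hN hp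
  obtain ⟨M, hM⟩ := (isCompact_Icc (a := 0) (b := ρ)).exists_bound_of_continuousOn
    (hu.continuousOn.mono fun t ht => ⟨ht.1, ht.2.trans_lt hρ.2⟩)
  obtain ⟨ε, hMε, hε⟩ : ∃ ε, M < uInf N p ε ∧ ε ∈ Ioo 0 ρ :=
    ((((tendsto_rpow_neg_nhdsGT_zero (neg_lt_zero.2 hα)).const_mul_atTop hb).eventually_gt_atTop
      M).and (Ioo_mem_nhdsGT hρ.1)).exists
  have hsub : ∀ t ∈ Icc ε ρ, t ∈ Ioo (0 : ℝ) 1 := fun t ht =>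
    ⟨hε.1.trans_le ht.1, ht.2.trans_lt hρ.2⟩
  have hu' : ContDiffOn ℝ 2 u (Ioo 0 1) := hu.mono Ioo_subset_Ico_self
  have hdu : ContDiffOn ℝ 1 (deriv u) (Ioo 0 1) :=
    hu'.deriv_of_isOpen isOpen_Ioo (by norm_num)
  have hU : ∀ t ∈ Ioo (0 : ℝ) 1, HasDerivAt (uInf N p) (bInf N p * -α * t ^ (-α - 1)) t :=
    fun t ht => hasDerivAt_const_mul_rpow ht.1 _ _
  have hne : ∀ t ∈ Icc ε ρ, (1 - t ^ 2) ≠ 0 := fun t ht => by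
    have := hsub t ht
    nlinarith [this.1, this.2]
  have hne' : ∀ t ∈ Icc ε ρ, t ≠ 0 := fun t ht => (hsub t ht).1.ne'
  have heq : EqOn u (uInf N p) (Icc ε ρ) := by
    refine eqOn_of_second_order_ode
      (A := fun t => -(((N : ℝ) - 1) / t - 2 * (α + 1) * t) / (1 - t ^ 2))
      (B := fun t => α * (α + 1) / (1 - t ^ 2)) (C := fun t => -1 / (1 - t ^ 2))
      (f := fun z => |z| ^ (p - 1) * z) (x' := deriv u)
      (y' := fun t => bInf N p * -α * t ^ (-α - 1)) ?_ ?_ ?_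
      (exists_lipschitzOnWith_abs_rpow_mul hp1) ?_ ?_ (fun t ht => hU t (hsub t ht)) ?_ h0
      (h1.trans (hU ρ hρ).deriv)
    · fun_prop (disch := assumption)
    · fun_prop (disch := assumption)
    · fun_prop (disch := assumption)
    · exact fun t ht => ((hu'.differentiableOn two_ne_zero).differentiableAt
        (isOpen_Ioo.mem_nhds (hsub t ht))).hasDerivAt
    · intro t ht
      have ht' := hsub t ht
      have hd := ((hdu.differentiableOn one_ne_zero).differentiableAt
        (isOpen_Ioo.mem_nhds ht')).hasDerivAt
      rwa [(profile_second_deriv_iff ht'.1 ht'.2 N p _ _ _ _).1 (hsol t ht')] at hd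
    · intro t ht
      have ht' := hsub t ht
      have hd := hasDerivAt_const_mul_rpow ht'.1 (bInf N p * -α) (-α - 1)
      convert hd using 1
      refine ((profile_second_deriv_iff ht'.1 ht'.2 N p _ _ _ _).1 ?_).symm
      rw [abs_uInf_rpow hN hp hp1 ht'.1, uInf, ← hαdef, Real.rpow_sub ht'.1 (-α - 1) 1,
        Real.rpow_sub ht'.1 (-α) 1, Real.rpow_neg ht'.1.le 2, Real.rpow_one, Real.rpow_two]
      have := ht'.1.ne'
      field_simp
      ring
  have := (le_abs_self _).trans (hM ε ⟨hε.1.le, hε.2.le⟩)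
  rw [heq ⟨le_rfl, hε.2.le⟩] at this
  linarith

lemma contDiffOn_wFun {N : ℕ} {p : ℝ} (hN : 3 ≤ N) (hp : 1 + 4 / ((N : ℝ) - 2) < p)
    {u : ℝ → ℝ → ℝ} {c : ℝ} (hu : ContDiffOn ℝ 2 (u c) (Ico 0 1)) :
    ContDiffOn ℝ 2 (wFun N p u c) (Ioo 0 1) := by
  have hU : ContDiffOn ℝ 2 (uInf N p) (Ioo 0 1) := contDiffOn_const.mul
    (contDiffOn_id.rpow_const_of_ne fun t ht => ht.1.ne')
  exact ((hu.mono Ioo_subset_Ico_self).div hU fun t ht => (uInf_pos hN hp ht.1).ne').sub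
    contDiffOn_const

theorem deriv_wFun_ne_zero {N : ℕ} {p : ℝ} (hN : 3 ≤ N) (hp : 1 + 4 / ((N : ℝ) - 2) < p)
    {u : ℝ → ℝ → ℝ} {c : ℝ} (hu : ContDiffOn ℝ 2 (u c) (Ico 0 1))
    (hsol : IsSolOn N p (u c) (Ioo 0 1)) {ρ : ℝ} (hρ : ρ ∈ Ioo (0 : ℝ) 1)
    (h0 : wFun N p u c ρ = 0) : deriv (wFun N p u c) ρ ≠ 0 := by
  intro h1
  have hpos := uInf_pos hN hp hρ.1
  refine profile_ne_of_tangent hN hp hu hsol hρ ?_ ?_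
  · rwa [wFun, sub_eq_zero, div_eq_one_iff_eq hpos.ne'] at h0
  · have hw := (((contDiffOn_wFun hN hp hu).differentiableOn two_ne_zero).differentiableAt
      (isOpen_Ioo.mem_nhds hρ)).hasDerivAt
    have hU : DifferentiableAt ℝ (uInf N p) ρ :=
      (hasDerivAt_const_mul_rpow hρ.1 _ _).differentiableAt
    have hprod := (hw.add_const 1).mul hU.hasDerivAt
    have heq : u c =ᶠ[𝓝 ρ] (fun t => wFun N p u c t + 1) * uInf N p := by
      filter_upwards [isOpen_Ioo.mem_nhds hρ] with t ht
      have := (uInf_pos hN hp ht.1).ne'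
      simp [wFun, this]
    simpa [h0, h1] using (hprod.congr_of_eventuallyEq heq).deriv

theorem stmt8 (N : ℕ) (p : ℝ) (hN : 3 ≤ N) (hp : 1 + 4 / ((N : ℝ) - 2) < p)
    (u : ℝ → ℝ → ℝ)
    (hu : ∀ c : ℝ,
      ContDiffOn ℝ 2 (u c) (Ico 0 1) ∧
      IsSolOn N p (u c) (Ioo 0 1) ∧
      u c 0 = c ∧
      derivWithin (u c) (Ici 0) 0 = 0)
    (Θ : ℝ → ℝ → ℝ)
    (hΘcont : ContinuousOn (fun q : ℝ × ℝ => Θ q.1 q.2) (Ico 0 1 ×ˢ Ici 0))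
    (hΘtan : ∀ ρ ∈ Ico (0 : ℝ) 1, ∀ c : ℝ, 0 ≤ c → wFun N p u c ρ ≠ 0 →
      Real.tan (Θ ρ c) = ρ * deriv (wFun N p u c) ρ / wFun N p u c ρ)
    (hΘhalf : ∀ ρ ∈ Ico (0 : ℝ) 1, ∀ c : ℝ, 0 ≤ c →
      ((∃ k : ℤ, Θ ρ c = Real.pi / 2 + (k : ℝ) * Real.pi) ↔ wFun N p u c ρ = 0))
    (hΘ0 : ∀ c : ℝ, 0 ≤ c → Θ 0 c = Real.pi) :
    ∀ ρ₁ ρ₂ : ℝ, 0 ≤ ρ₁ → ρ₁ < ρ₂ → ρ₂ < 1 → ∀ c : ℝ, 0 ≤ c →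
      {ρ ∈ Ico ρ₁ ρ₂ | wFun N p u c ρ = 0}.Finite ∧
      ({ρ ∈ Ico ρ₁ ρ₂ | wFun N p u c ρ = 0}.ncard : ℤ) =
        ⌊Θ ρ₁ c / Real.pi - 1 / 2⌋ - ⌊Θ ρ₂ c / Real.pi - 1 / 2⌋ := by
  intro ρ₁ ρ₂ h₁ h₁₂ h₂ c hc
  obtain ⟨huC, hsol, -, -⟩ := hu c
  have hpi := Real.pi_pos
  set φ : ℝ → ℝ := fun t => Θ t c / Real.pi - 1 / 2 with hφdef
  have hmem : ∀ t ∈ Icc ρ₁ ρ₂, t ∈ Ico (0 : ℝ) 1 := fun t ht =>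
    ⟨h₁.trans ht.1, ht.2.trans_lt h₂⟩
  have hφI : ContinuousOn φ (Ico 0 1) :=
    ((hΘcont.comp (f := fun t : ℝ => (t, c)) (by fun_prop) fun t ht => ⟨ht, hc⟩).div_const
      Real.pi).sub continuousOn_const
  have hiff : ∀ t ∈ Ico (0 : ℝ) 1, (∃ k : ℤ, φ t = k) ↔ wFun N p u c t = 0 := by
    intro t ht
    rw [← hΘhalf t ht c hc]
    refine exists_congr fun k => ?_
    simp only [hφdef]
    rw [sub_eq_iff_eq_add, div_eq_iff hpi.ne']
    constructor <;> intro h <;> linarith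
  have hset : {ρ ∈ Ico ρ₁ ρ₂ | wFun N p u c ρ = 0} = {t ∈ Ico ρ₁ ρ₂ | ∃ k : ℤ, φ t = k} := by
    ext t
    exact and_congr_right fun ht => (hiff t (hmem t ⟨ht.1, ht.2.le⟩)).symm
  rw [hset]
  refine floorDropCounts_of_strict_crossing h₁₂.le (hφI.mono hmem) fun x hx k hk => ?_
  have hx1 := hmem x hx
  have hx0 : x ≠ 0 := by
    rintro rfl
    simp only [hφdef, hΘ0 c hc, div_self hpi.ne'] at hk
    have h2 : (1 : ℝ) = 2 * k := by linarith
    norm_cast at h2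
    omega
  have hxI : x ∈ Ioo (0 : ℝ) 1 := ⟨lt_of_le_of_ne hx1.1 hx0.symm, hx1.2⟩
  have hw0 : wFun N p u c x = 0 := (hiff x hx1).1 ⟨k, hk⟩
  have hdc : ContinuousAt (deriv (wFun N p u c)) x :=
    ((contDiffOn_wFun hN hp huC).continuousOn_deriv_of_isOpen isOpen_Ioo
      (by norm_num)).continuousAt
      (isOpen_Ioo.mem_nhds hxI)
  have hsign := eventually_deriv_div_sign hw0 (deriv_wFun_ne_zero hN hp huC hsol hxI hw0) hdc
  have hφx : ContinuousAt φ x :=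
    (hφI.mono Ioo_subset_Ico_self).continuousAt (isOpen_Ioo.mem_nhds hxI)
  have hev : ∀ᶠ y in 𝓝 x, (x < y → φ y < k) ∧ (y < x → k < φ y) := by
    filter_upwards [hsign, isOpen_Ioo.mem_nhds hxI,
      hφx.eventually_const_lt (show (k : ℝ) - 1 / 2 < φ x by rw [hk]; linarith),
      hφx.eventually_lt_const (show φ x < k + 1 / 2 by rw [hk]; linarith)] with y hy hyI hl hr
    have htan := hΘtan y ⟨hyI.1.le, hyI.2⟩ c hc
    rw [mul_div_assoc] at htan
    constructor <;> intro hxy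
    · have hq := hy.1 hxy
      have hwy : wFun N p u c y ≠ 0 := fun h => by simp [h] at hq
      exact div_pi_lt_of_tan_pos hr (by rw [htan hwy]; exact mul_pos hyI.1 hq)
    · have hq := hy.2 hxy
      have hwy : wFun N p u c y ≠ 0 := fun h => by simp [h] at hq
      exact lt_div_pi_of_tan_neg hl (by rw [htan hwy]; exact mul_neg_of_pos_of_neg hyI.1 hq)
  exact ⟨eventually_nhdsWithin_iff.2 (hev.mono fun y hy => hy.1),
    eventually_nhdsWithin_iff.2 (hev.mono fun y hy => hy.2)⟩
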